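/- Let A ∈ ℝ^{m×n} satisfy the RIP of order K with constant δ_K ∈ (0, 1), let b ∈ ℝ^m, μ > 0, λ ≥ 0. Suppose x' is a stationary point of r_{μ,λ}(x) + ‖Ax − b‖², i.e. 2z' ∈ ∂g_λ(x') with z' = (I − AᵀA)x' + Aᵀb, and that |z'ᵢ| ∉ [(1−δ_K)√μ + λ/2, √μ/(1−δ_K) + λ/2] for every i. If x'' ≠ x' is another stationary point (i.e. 2((I − AᵀA)x'' + Aᵀb) ∈ ∂g_λ(x'')), then ‖x'' − x'‖₀ > K. -/

import Mathlib

noncomputable section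

open scoped BigOperators

open Matrix

/-- ℓ¹ norm -/
def l1 {ι : Type*} [Fintype ι] (x : ι → ℝ) : ℝ := ∑ i, |x i|

/-- ℓ⁰ "norm": the number of nonzero entries of `x` -/
def l0 {ι : Type*} [Fintype ι] (x : ι → ℝ) : ℕ :=
  (Finset.univ.filter fun i => x i ≠ 0).card

/-- squared Euclidean norm -/
def sqnorm {ι : Type*} [Fintype ι] (x : ι → ℝ) : ℝ := ∑ i, (x i) ^ 2

/-- Euclidean inner product -/
def ip {ι : Type*} [Fintype ι] (x y : ι → ℝ) : ℝ := ∑ i, x i * y i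

/-- restricted isometry property of order `K` with constant `δ` -/
def RIP {m n : ℕ} (A : Matrix (Fin m) (Fin n) ℝ) (K : ℕ) (δ : ℝ) : Prop :=
  ∀ x : Fin n → ℝ, l0 x ≤ K →
    (1 - δ) * sqnorm x ≤ sqnorm (A *ᵥ x) ∧ sqnorm (A *ᵥ x) ≤ (1 + δ) * sqnorm x

/-- the regularizer `r_{μ,λ}(x) = Σᵢ (μ − max(√μ − |xᵢ|, 0)²) + λ‖x‖₁` -/
def reg {n : ℕ} (μ lam : ℝ) (x : Fin n → ℝ) : ℝ :=
  (∑ i, (μ - max (Real.sqrt μ - |x i|) 0 ^ 2)) + lam * l1 x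

/-- `g_λ = r_{μ,λ} + ‖·‖²` -/
def gfun {n : ℕ} (μ lam : ℝ) (x : Fin n → ℝ) : ℝ := reg μ lam x + sqnorm x

/-- subdifferential of a convex function on ℝⁿ -/
def subdiff {n : ℕ} (g : (Fin n → ℝ) → ℝ) (x : Fin n → ℝ) : Set (Fin n → ℝ) :=
  {s | ∀ y, g x + ip s (y - x) ≤ g y}


/-- the scalar summand of `gfun`, in terms of `s = √μ` -/
def gscalar (s lam t : ℝ) : ℝ := s ^ 2 - max (s - |t|) 0 ^ 2 + lam * |t| + t ^ 2

lemma gfun_eq_sum {n : ℕ} {μ : ℝ} (hμ : 0 ≤ μ) (lam : ℝ) (x : Fin n → ℝ) :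
    gfun μ lam x = ∑ i, gscalar (Real.sqrt μ) lam (x i) := by
  simp only [gfun, reg, l1, sqnorm, gscalar, Real.sq_sqrt hμ, Finset.sum_add_distrib,
    Finset.mul_sum]

lemma gscalar_neg (s lam t : ℝ) : gscalar s lam (-t) = gscalar s lam t := by
  simp [gscalar]

/-- Subgradients of the separable function `gfun` are coordinatewise subgradients. -/
lemma gscalar_subgradient {n : ℕ} {μ lam : ℝ} (hμ : 0 ≤ μ) {x z : Fin n → ℝ}
    (h : (2 : ℝ) • z ∈ subdiff (gfun μ lam) x) (i : Fin n) (t : ℝ) :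
    gscalar (Real.sqrt μ) lam (x i) + 2 * z i * (t - x i) ≤ gscalar (Real.sqrt μ) lam t := by
  have h1 := h (Function.update x i t)
  rw [gfun_eq_sum hμ, gfun_eq_sum hμ, ip,
    ← Finset.add_sum_erase _ _ (Finset.mem_univ i),
    ← Finset.add_sum_erase _ (fun j => gscalar _ lam (Function.update x i t j))
      (Finset.mem_univ i),
    ← Finset.add_sum_erase _ (fun j => ((2 : ℝ) • z) j * (Function.update x i t - x) j)
      (Finset.mem_univ i)] at h1
  have h2 : ∑ j ∈ Finset.univ.erase i, ((2 : ℝ) • z) j * (Function.update x i t - x) j = 0 :=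
    Finset.sum_eq_zero fun j hj => by simp [Finset.ne_of_mem_erase hj]
  have h3 : ∑ j ∈ Finset.univ.erase i, gscalar (Real.sqrt μ) lam (Function.update x i t j) =
      ∑ j ∈ Finset.univ.erase i, gscalar (Real.sqrt μ) lam (x j) :=
    Finset.sum_congr rfl fun j hj => by simp [Finset.ne_of_mem_erase hj]
  rw [h2, h3] at h1
  simp only [Function.update_self, Pi.sub_apply, Pi.smul_apply, smul_eq_mul] at h1
  linarith

lemma gscalar_le_quadratic {s lam x t : ℝ} (hx : 0 ≤ x) (ht : 0 ≤ t) :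
    gscalar s lam t ≤
      gscalar s lam x + 2 * (max x s + lam / 2) * (t - x) + (t - x) ^ 2 := by
  simp only [gscalar, abs_of_nonneg hx, abs_of_nonneg ht]
  rcases le_total s t with h1 | h1 <;> rcases le_total s x with h2 | h2 <;>
    simp only [max_eq_left, max_eq_right, sub_nonneg, sub_nonpos, h1, h2] <;>
    nlinarith [mul_nonneg (sub_nonneg.2 h1) (sub_nonneg.2 h2)]

lemma subgradient_of_pos {s lam x z : ℝ} (hx : 0 < x)
    (h : ∀ t, gscalar s lam x + 2 * z * (t - x) ≤ gscalar s lam t) :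
    z = max x s + lam / 2 := by
  have key : ∀ r, -x ≤ r → 2 * (z - (max x s + lam / 2)) * r ≤ r ^ 2 := fun r hr => by
    have h1 := h (x + r)
    have h2 := gscalar_le_quadratic (s := s) (lam := lam) hx.le (by linarith : 0 ≤ x + r)
    rw [add_sub_cancel_left] at h1 h2
    linarith
  generalize max x s + lam / 2 = c at key
  rcases lt_trichotomy z c with hlt | heq | hgt
  · have h1 := key (-min x (c - z)) (neg_le_neg (min_le_left _ _))
    have h2 : 0 < min x (c - z) := lt_min hx (sub_pos.2 hlt)
    nlinarith [min_le_right x (c - z)]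
  · exact heq
  · nlinarith [key (z - c) (by linarith)]

lemma subgradient_neg {s lam x z : ℝ}
    (h : ∀ t, gscalar s lam x + 2 * z * (t - x) ≤ gscalar s lam t) (t : ℝ) :
    gscalar s lam (-x) + 2 * -z * (t - -x) ≤ gscalar s lam t := by
  have h1 := h (-t)
  rw [gscalar_neg] at h1 ⊢
  linarith

lemma subgradient_of_neg {s lam x z : ℝ} (hx : x < 0)
    (h : ∀ t, gscalar s lam x + 2 * z * (t - x) ≤ gscalar s lam t) :
    -z = max (-x) s + lam / 2 :=
  subgradient_of_pos (neg_pos.2 hx) (subgradient_neg h)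

lemma subgradient_zero_le {s lam z : ℝ} (hs : 0 < s)
    (h : ∀ t, gscalar s lam 0 + 2 * z * (t - 0) ≤ gscalar s lam t) :
    z ≤ s + lam / 2 := by
  have h1 := h s
  simp only [gscalar, abs_zero, abs_of_pos hs, sub_zero, sub_self, max_self,
    max_eq_left hs.le] at h1
  nlinarith

lemma abs_subgradient_zero_le {s lam z : ℝ} (hs : 0 < s)
    (h : ∀ t, gscalar s lam 0 + 2 * z * (t - 0) ≤ gscalar s lam t) :
    |z| ≤ s + lam / 2 := by
  refine abs_le'.2 ⟨subgradient_zero_le hs h, subgradient_zero_le hs ?_⟩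
  simpa using subgradient_neg h

/-- Strong monotonicity of the subdifferential when `z` exceeds the excluded interval. -/
lemma subgradient_strong_mono_of_large {s lam δ x z y w : ℝ} (hs : 0 < s) (hlam : 0 ≤ lam)
    (hδ : δ ∈ Set.Ioo (0 : ℝ) 1)
    (hx : ∀ t, gscalar s lam x + 2 * z * (t - x) ≤ gscalar s lam t)
    (hy : ∀ t, gscalar s lam y + 2 * w * (t - y) ≤ gscalar s lam t)
    (hz : s / (1 - δ) + lam / 2 < z) (hxy : y ≠ x) :
    δ * (y - x) ^ 2 < (w - z) * (y - x) := by
  obtain ⟨hδ0, hδ1⟩ := hδ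
  have hd : 0 < 1 - δ := sub_pos.2 hδ1
  have hsd : s < s / (1 - δ) := by
    rw [lt_div_iff₀ hd]
    nlinarith
  have hx0 : 0 < x := by
    rcases lt_trichotomy x 0 with hneg | rfl | hpos
    · have h1 := subgradient_of_neg hneg hx
      have h2 := le_max_right (-x) s
      linarith
    · have h1 := subgradient_zero_le hs hx
      linarith
    · exact hpos
  have hzx := subgradient_of_pos hx0 hx
  have hsx : s < x := by
    by_contra! hle
    rw [max_eq_right hle] at hzx
    linarith
  rw [max_eq_left hsx.le] at hzx
  have hsx' : s < x * (1 - δ) := by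
    rw [← div_lt_iff₀ hd]
    linarith
  have hsq : 0 < (y - x) ^ 2 := by
    have := sub_ne_zero.2 hxy
    positivity
  have of_small : 0 ≤ y → y < x → w ≤ s + lam / 2 → δ * (y - x) ^ 2 < (w - z) * (y - x) :=
    fun h0 hyx hw => by
      have h1 : δ * (x - y) < z - w := by nlinarith
      nlinarith [mul_lt_mul_of_pos_right h1 (sub_pos.2 hyx)]
  rcases lt_trichotomy y 0 with hneg | rfl | hpos
  · have h1 := subgradient_of_neg hneg hy
    have h2 := le_max_left (-y) s
    have h3 : δ * (x - y) < z - w := by nlinarith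
    nlinarith [mul_lt_mul_of_pos_right h3 (by linarith : 0 < x - y)]
  · exact of_small le_rfl hx0 (subgradient_zero_le hs hy)
  · have h1 := subgradient_of_pos hpos hy
    rcases le_total s y with h | h
    · rw [max_eq_left h] at h1
      rw [h1, hzx]
      nlinarith
    · rw [max_eq_right h] at h1
      exact of_small hpos.le (by linarith) h1.le

/-- Strong monotonicity of the subdifferential when `z` is below the excluded interval. -/
lemma subgradient_strong_mono_of_small {s lam δ x z y w : ℝ} (hs : 0 < s)
    (hδ : δ ∈ Set.Ioo (0 : ℝ) 1)
    (hx : ∀ t, gscalar s lam x + 2 * z * (t - x) ≤ gscalar s lam t)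
    (hy : ∀ t, gscalar s lam y + 2 * w * (t - y) ≤ gscalar s lam t)
    (hz : |z| < (1 - δ) * s + lam / 2) (hxy : y ≠ x) :
    δ * (y - x) ^ 2 < (w - z) * (y - x) := by
  obtain ⟨hδ0, hδ1⟩ := hδ
  obtain ⟨hz1, hz2⟩ := abs_lt.1 hz
  have hds : (1 - δ) * s < s := by nlinarith
  have hx0 : x = 0 := by
    rcases lt_trichotomy x 0 with hneg | h | hpos
    · have h1 := subgradient_of_neg hneg hx
      have h2 := le_max_right (-x) s
      linarith
    · exact h
    · have h1 := subgradient_of_pos hpos hx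
      have h2 := le_max_right x s
      linarith
  subst hx0
  rcases lt_or_gt_of_ne hxy with hneg | hpos
  · have h1 := subgradient_of_neg hneg hy
    have h2 := le_max_left (-y) s
    have h3 := le_max_right (-y) s
    have h4 : δ * -y < z - w := by nlinarith
    nlinarith [mul_lt_mul_of_pos_right h4 (neg_pos.2 hneg)]
  · have h1 := subgradient_of_pos hpos hy
    have h2 := le_max_left y s
    have h3 := le_max_right y s
    have h4 : δ * y < w - z := by nlinarith
    nlinarith [mul_lt_mul_of_pos_right h4 hpos]

lemma subgradient_strong_mono {s lam δ x z y w : ℝ} (hs : 0 < s) (hlam : 0 ≤ lam)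
    (hδ : δ ∈ Set.Ioo (0 : ℝ) 1)
    (hx : ∀ t, gscalar s lam x + 2 * z * (t - x) ≤ gscalar s lam t)
    (hy : ∀ t, gscalar s lam y + 2 * w * (t - y) ≤ gscalar s lam t)
    (hz : |z| ∉ Set.Icc ((1 - δ) * s + lam / 2) (s / (1 - δ) + lam / 2)) (hxy : y ≠ x) :
    δ * (y - x) ^ 2 < (w - z) * (y - x) := by
  rw [Set.mem_Icc, not_and_or, not_le, not_le] at hz
  rcases hz with hz | hz
  · exact subgradient_strong_mono_of_small hs hδ hx hy hz hxy
  rcases lt_abs.1 hz with hz | hz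
  · exact subgradient_strong_mono_of_large hs hlam hδ hx hy hz hxy
  · have := subgradient_strong_mono_of_large hs hlam hδ (subgradient_neg hx)
      (subgradient_neg hy) hz (neg_injective.ne hxy)
    linarith

lemma sqnorm_mulVec {m n : ℕ} (A : Matrix (Fin m) (Fin n) ℝ) (d : Fin n → ℝ) :
    sqnorm (A *ᵥ d) = ∑ i, (Aᵀ *ᵥ (A *ᵥ d)) i * d i := by
  calc sqnorm (A *ᵥ d) = (A *ᵥ d) ⬝ᵥ (A *ᵥ d) := by simp [sqnorm, dotProduct, sq]
    _ = (Aᵀ *ᵥ (A *ᵥ d)) ⬝ᵥ d := by rw [Matrix.dotProduct_mulVec, Matrix.mulVec_transpose]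

/-- Theorem 3 (separation of stationary points): two stationary points of
`r_{μ,λ}(x) + ‖Ax − b‖²` are separated by `‖x'' − x'‖₀ > K`. -/
theorem stmt11 {m n : ℕ} (A : Matrix (Fin m) (Fin n) ℝ) (b : Fin m → ℝ)
    (K : ℕ) (δ : ℝ) (hδ : δ ∈ Set.Ioo (0:ℝ) 1) (hRIP : RIP A K δ)
    (μ lam : ℝ) (hμ : 0 < μ) (hlam : 0 ≤ lam)
    (x' z' : Fin n → ℝ)
    (hz' : z' = x' - Aᵀ *ᵥ (A *ᵥ x') + Aᵀ *ᵥ b)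
    (hstat : (2:ℝ) • z' ∈ subdiff (gfun μ lam) x')
    (hout : ∀ i, |z' i| ∉
      Set.Icc ((1 - δ) * Real.sqrt μ + lam / 2) (Real.sqrt μ / (1 - δ) + lam / 2))
    (x'' : Fin n → ℝ) (hne : x'' ≠ x')
    (hstat'' : (2:ℝ) • (x'' - Aᵀ *ᵥ (A *ᵥ x'') + Aᵀ *ᵥ b)
      ∈ subdiff (gfun μ lam) x'') :
    K < l0 (x'' - x') := by
  by_contra! hK
  have hs : 0 < Real.sqrt μ := Real.sqrt_pos.2 hμ
  have hrip := (hRIP _ hK).1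
  set z'' := x'' - Aᵀ *ᵥ (A *ᵥ x'') + Aᵀ *ᵥ b with hz''
  have hmono : ∀ i, x'' i ≠ x' i →
      δ * (x'' i - x' i) ^ 2 < (z'' i - z' i) * (x'' i - x' i) := fun i hi =>
    subgradient_strong_mono hs hlam hδ (gscalar_subgradient hμ.le hstat i)
      (gscalar_subgradient hμ.le hstat'' i) (hout i) hi
  obtain ⟨j, hj⟩ := Function.ne_iff.1 hne
  have hlt : ∑ i, δ * (x'' i - x' i) ^ 2 < ∑ i, (z'' i - z' i) * (x'' i - x' i) := by
    refine Finset.sum_lt_sum (fun i _ => ?_) ⟨j, Finset.mem_univ j, hmono j hj⟩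
    by_cases hi : x'' i = x' i
    · simp [hi]
    · exact (hmono i hi).le
  have heq : ∑ i, (z'' i - z' i) * (x'' i - x' i) =
      sqnorm (x'' - x') - sqnorm (A *ᵥ (x'' - x')) := by
    rw [sqnorm_mulVec, sqnorm, ← Finset.sum_sub_distrib]
    refine Finset.sum_congr rfl fun i _ => ?_
    simp only [hz'', hz', Matrix.mulVec_sub, Pi.sub_apply, Pi.add_apply]
    ring
  have hδsum : ∑ i, δ * (x'' i - x' i) ^ 2 = δ * sqnorm (x'' - x') := by
    simp [sqnorm, Finset.mul_sum]
  linarith
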